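/- arXiv:1510.02848 — 2 statements merged into one kernel-verified Lean document; each statement's English description precedes it below -/
import Mathlib

section
/- Assume G and the subgraph G_I induced on the interior nodes are connected. If there exist ρ_1, ρ_2 ∈ ℂ_0^E with P(ρ_1,ρ_2) = ℂ^E, then every equivalence class of conductivities in ℂ_0^E for the equivalence relation Λ_{γ_1,0} = Λ_{γ_2,0} has Lebesgue measure zero in ℂ^E; that is, for every γ_0 ∈ ℂ_0^E, the set {γ ∈ ℂ_0^E : Λ_{γ,0} = Λ_{γ_0,0}} has Lebesgue measure zero. -/
/-!
Common setup: a finite graph whose vertex set is partitioned into boundary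
nodes `B` and interior nodes `I` (so the vertex set is `B ⊕ I`), with edge
set `E` and a fixed orientation given by maps `head tail : E → B ⊕ I`.
-/

open Matrix MeasureTheory

namespace DIP

noncomputable section

variable {B I E : Type*} [Fintype B] [Fintype I] [Fintype E]
  [DecidableEq B] [DecidableEq I] [DecidableEq E]

/-- Discrete gradient: `(∇u)(e) = u(head e) - u(tail e)`. -/
def grad (head tail : E → B ⊕ I) (u : B ⊕ I → ℂ) : E → ℂ :=
  fun e => u (head e) - u (tail e)

/-- Signed incidence matrix over a commutative ring `α`. -/
def incMat (α : Type*) [CommRing α] (head tail : E → B ⊕ I) : Matrix E (B ⊕ I) α :=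
  Matrix.of fun e v => (if v = head e then (1 : α) else 0) - (if v = tail e then (1 : α) else 0)

/-- Weighted graph Laplacian `L_γ = ∇ᵀ diag(γ) ∇`. -/
def lap (α : Type*) [CommRing α] (head tail : E → B ⊕ I) (γ : E → α) :
    Matrix (B ⊕ I) (B ⊕ I) α :=
  (incMat α head tail)ᵀ * Matrix.diagonal γ * incMat α head tail

/-- The `II` block of the weighted graph Laplacian. -/
def lapII (α : Type*) [CommRing α] (head tail : E → B ⊕ I) (γ : E → α) : Matrix I I α :=
  (lap α head tail γ).submatrix Sum.inr Sum.inr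

/-- The `IB` block of the weighted graph Laplacian. -/
def lapIB (α : Type*) [CommRing α] (head tail : E → B ⊕ I) (γ : E → α) : Matrix I B α :=
  (lap α head tail γ).submatrix Sum.inr Sum.inl

/-- The `BI` block of the weighted graph Laplacian. -/
def lapBI (α : Type*) [CommRing α] (head tail : E → B ⊕ I) (γ : E → α) : Matrix B I α :=
  (lap α head tail γ).submatrix Sum.inl Sum.inr

/-- The `BB` block of the weighted graph Laplacian. -/
def lapBB (α : Type*) [CommRing α] (head tail : E → B ⊕ I) (γ : E → α) : Matrix B B α :=
  (lap α head tail γ).submatrix Sum.inl Sum.inl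

/-- Dirichlet-to-Neumann map
`Λ_{γ,q} = (L_γ)_BB - (L_γ)_BI [(L_γ)_II + diag(q)]⁻¹ (L_γ)_IB`. -/
def dtn (head tail : E → B ⊕ I) (γ : E → ℂ) (q : I → ℂ) : Matrix B B ℂ :=
  lapBB ℂ head tail γ -
    lapBI ℂ head tail γ * (lapII ℂ head tail γ + Matrix.diagonal q)⁻¹ * lapIB ℂ head tail γ

/-- `u` is `(γ,q)`-harmonic: `(L_γ u)_I + q ⊙ u_I = 0`. -/
def Harmonic (head tail : E → B ⊕ I) (γ : E → ℂ) (q : I → ℂ) (u : B ⊕ I → ℂ) : Prop :=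
  ∀ i : I, (lap ℂ head tail γ).mulVec u (Sum.inr i) + q i * u (Sum.inr i) = 0

/-- The graph `G` is connected. -/
def Gconn (head tail : E → B ⊕ I) : Prop :=
  (SimpleGraph.fromRel fun v w : B ⊕ I => ∃ e, head e = v ∧ tail e = w).Connected

/-- The subgraph of `G` induced on the interior nodes is connected. -/
def GIconn (head tail : E → B ⊕ I) : Prop :=
  (SimpleGraph.fromRel fun i j : I => ∃ e, head e = Sum.inr i ∧ tail e = Sum.inr j).Connected

/-- `P(γ₁,γ₂)`: span of Hadamard products of gradients of harmonic functions. -/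
def Pspace (head tail : E → B ⊕ I) (γ₁ γ₂ : E → ℂ) : Submodule ℂ (E → ℂ) :=
  Submodule.span ℂ { w : E → ℂ | ∃ u v : B ⊕ I → ℂ,
    Harmonic head tail γ₁ 0 u ∧ Harmonic head tail γ₂ 0 v ∧
    w = fun e => grad head tail u e * grad head tail v e }

/-- `Q(q₁,q₂)`: span of Hadamard products of interior values of harmonic functions. -/
def Qspace (head tail : E → B ⊕ I) (γ : E → ℂ) (q₁ q₂ : I → ℂ) : Submodule ℂ (I → ℂ) :=
  Submodule.span ℂ { w : I → ℂ | ∃ u v : B ⊕ I → ℂ,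
    Harmonic head tail γ q₁ u ∧ Harmonic head tail γ q₂ v ∧
    w = fun i => u (Sum.inr i) * v (Sum.inr i) }

/-- The matrix `U(γ)` whose `i`-th column is the harmonic extension of the
standard basis vector `e_i ∈ ℂ^B`. -/
def Usol (head tail : E → B ⊕ I) (γ : E → ℂ) : Matrix (B ⊕ I) B ℂ :=
  Matrix.of (Sum.elim (fun b i => if b = i then (1 : ℂ) else 0)
    (fun j i => (-((lapII ℂ head tail γ)⁻¹ * lapIB ℂ head tail γ)) j i))

/-- The products-of-gradients matrix `F(γ₁,γ₂) ∈ ℂ^{|E| × |B|²}` whose column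
indexed by `(i,j)` is `(∇ U(γ₁))_{:,i} ⊙ (∇ U(γ₂))_{:,j}`. -/
def Fmat (head tail : E → B ⊕ I) (γ₁ γ₂ : E → ℂ) : Matrix E (B × B) ℂ :=
  Matrix.of fun e p =>
    grad head tail (fun v => Usol head tail γ₁ v p.1) e *
    grad head tail (fun v => Usol head tail γ₂ v p.2) e

/-- Smallest eigenvalue of a real symmetric matrix, as the minimum of its
Rayleigh quotient over the (Euclidean) unit sphere. -/
def lambdaMin (M : Matrix I I ℝ) : ℝ :=
  ⨅ x : { x : I → ℝ // ∑ i, x i ^ 2 = 1 }, (x : I → ℝ) ⬝ᵥ M.mulVec (x : I → ℝ)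


section helpers

set_option linter.unusedSectionVars false

open Polynomial


theorem const_of_conn {X : Type*} (head tail : E → B ⊕ I) (hG : Gconn head tail)
    (u : B ⊕ I → X) (h : ∀ e, u (head e) = u (tail e)) (v w : B ⊕ I) : u v = u w := by
  obtain ⟨p⟩ := hG.preconnected v w
  induction p with
  | nil => rfl
  | cons hadj _ ih =>
    rw [← ih]
    rw [SimpleGraph.fromRel_adj] at hadj
    rcases hadj with ⟨_, ⟨e, rfl, rfl⟩ | ⟨e, rfl, rfl⟩⟩
    · exact h e
    · exact (h e).symm

theorem incMat_mulVec (head tail : E → B ⊕ I) (u : B ⊕ I → ℂ) :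
    incMat ℂ head tail *ᵥ u = grad head tail u := by
  ext e
  simp [Matrix.mulVec, dotProduct, incMat, grad, sub_mul, Finset.sum_sub_distrib]

theorem lap_blocks (α : Type*) [CommRing α] (head tail : E → B ⊕ I) (γ : E → α) :
    lap α head tail γ = Matrix.fromBlocks (lapBB α head tail γ) (lapBI α head tail γ)
      (lapIB α head tail γ) (lapII α head tail γ) :=
  (Matrix.fromBlocks_toBlocks (lap α head tail γ)).symm

theorem det_lapII_ne [Nonempty B] (head tail : E → B ⊕ I) (hG : Gconn head tail)
    (γ : E → ℂ) (hγ : ∀ e, 0 < (γ e).re) : (lapII ℂ head tail γ).det ≠ 0 := by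
  intro h0
  obtain ⟨x, hx, hx0⟩ := Matrix.exists_mulVec_eq_zero_iff.2 h0
  apply hx
  set u : B ⊕ I → ℂ := Sum.elim 0 x with hu
  have h1 : star u ⬝ᵥ (lap ℂ head tail γ *ᵥ u) = 0 := by
    rw [lap_blocks, Matrix.fromBlocks_mulVec]
    simp only [hu, Sum.elim_comp_inl, Sum.elim_comp_inr, hx0]
    simp [dotProduct]
  have h2 : star u ⬝ᵥ (lap ℂ head tail γ *ᵥ u)
      = ∑ e, γ e * (Complex.normSq (grad head tail u e) : ℂ) := by
    rw [lap, ← Matrix.mulVec_mulVec, incMat_mulVec, ← Matrix.mulVec_mulVec,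
      Matrix.dotProduct_mulVec, Matrix.vecMul_transpose, incMat_mulVec, dotProduct]
    refine Finset.sum_congr rfl fun e _ => ?_
    rw [Matrix.mulVec_diagonal, Complex.normSq_eq_conj_mul_self]
    simp only [grad, Pi.star_apply, map_sub]
    simp only [Complex.star_def]
    ring
  rw [h1] at h2
  have h3 : ∑ e, (γ e).re * Complex.normSq (grad head tail u e) = 0 := by
    have := congrArg Complex.re h2
    simpa using this.symm
  have h4 : ∀ e, grad head tail u e = 0 := by
    intro e
    have := (Finset.sum_eq_zero_iff_of_nonneg
      (fun e _ => mul_nonneg (hγ e).le (Complex.normSq_nonneg _))).1 h3 e (Finset.mem_univ e)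
    rcases mul_eq_zero.1 this with h | h
    · exact absurd h (hγ e).ne'
    · exact Complex.normSq_eq_zero.1 h
  obtain ⟨b⟩ := ‹Nonempty B›
  ext i
  have := const_of_conn head tail hG u (fun e => sub_eq_zero.1 (h4 e)) (Sum.inr i) (Sum.inl b)
  simpa [hu] using this

/-- scaled harmonic extension matrix -/
def Ut (α : Type*) [CommRing α] (head tail : E → B ⊕ I) (γ : E → α) : Matrix (B ⊕ I) B α :=
  Matrix.fromRows ((lapII α head tail γ).det • (1 : Matrix B B α))
    (-((lapII α head tail γ).adjugate * lapIB α head tail γ))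

/-- gradient of the scaled harmonic extension matrix -/
def Gt (α : Type*) [CommRing α] (head tail : E → B ⊕ I) (γ : E → α) : Matrix E B α :=
  incMat α head tail * Ut α head tail γ

/-- scaled products matrix -/
def Ft (α : Type*) [CommRing α] (head tail : E → B ⊕ I) (γ₁ γ₂ : E → α) :
    Matrix E (B × B) α :=
  Matrix.of fun e p => Gt α head tail γ₁ e p.1 * Gt α head tail γ₂ e p.2

/-- the determinant -/
def ft (α : Type*) [CommRing α] (head tail : E → B ⊕ I) (R : Matrix (B × B) E α)
    (γ₁ γ₂ : E → α) : α :=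
  (Ft α head tail γ₁ γ₂ * R).det

section mapping
variable {α β : Type*} [CommRing α] [CommRing β] (φ : α →+* β) (head tail : E → B ⊕ I)

theorem incMat_map : (incMat α head tail).map φ = incMat β head tail := by
  ext e v
  simp [incMat, apply_ite φ]

theorem lap_map (γ : E → α) : (lap α head tail γ).map φ = lap β head tail (φ ∘ γ) := by
  simp only [lap, Matrix.map_mul, incMat_map]
  rw [Matrix.transpose_map, incMat_map]
  rw [Matrix.diagonal_map (map_zero φ)]
  rfl

theorem lapII_map (γ : E → α) : (lapII α head tail γ).map φ = lapII β head tail (φ ∘ γ) := by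
  rw [lapII, lapII, ← lap_map]; rfl

theorem lapIB_map (γ : E → α) : (lapIB α head tail γ).map φ = lapIB β head tail (φ ∘ γ) := by
  rw [lapIB, lapIB, ← lap_map]; rfl

theorem Ut_map (γ : E → α) : (Ut α head tail γ).map φ = Ut β head tail (φ ∘ γ) := by
  have hd := φ.map_det (lapII α head tail γ)
  have ha := φ.map_adjugate (lapII α head tail γ)
  simp only [RingHom.mapMatrix_apply, lapII_map] at hd ha
  have hm := Matrix.map_mul (L := (lapII α head tail γ).adjugate) (M := lapIB α head tail γ) (f := φ)
  rw [ha, lapIB_map] at hm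
  ext (b | i) c
  · simp [Ut, hd, Matrix.one_apply, apply_ite φ]
  · have := congrFun (congrFun hm i) c
    simp only [Matrix.map_apply] at this
    simp [Ut, this]

theorem Gt_map (γ : E → α) : (Gt α head tail γ).map φ = Gt β head tail (φ ∘ γ) := by
  rw [Gt, Matrix.map_mul, incMat_map, Ut_map]; rfl

theorem ft_map (R : Matrix (B × B) E α) (γ₁ γ₂ : E → α) :
    φ (ft α head tail R γ₁ γ₂) = ft β head tail (R.map φ) (φ ∘ γ₁) (φ ∘ γ₂) := by
  rw [ft, ft, φ.map_det, RingHom.mapMatrix_apply, Matrix.map_mul]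
  congr 2
  ext e p
  simp [Ft, ← Gt_map]

end mapping

section homog
variable [Nonempty I] (head tail : E → B ⊕ I)

theorem lap_smul (c : ℂ) (γ : E → ℂ) : lap ℂ head tail (c • γ) = c • lap ℂ head tail γ := by
  rw [lap, lap, Matrix.diagonal_smul]
  simp

theorem Ut_smul (c : ℂ) (γ : E → ℂ) :
    Ut ℂ head tail (c • γ) = c ^ Fintype.card I • Ut ℂ head tail γ := by
  have h1 : lapII ℂ head tail (c • γ) = c • lapII ℂ head tail γ := by
    rw [lapII, lap_smul]; rfl
  have h2 : lapIB ℂ head tail (c • γ) = c • lapIB ℂ head tail γ := by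
    rw [lapIB, lap_smul]; rfl
  have h3 : c ^ Fintype.card I = c ^ (Fintype.card I - 1) * c := by
    rw [← pow_succ, Nat.sub_add_cancel Fintype.card_pos]
  rw [Ut, h1, h2, Matrix.det_smul, Matrix.adjugate_smul]
  ext (b | i) d
  · simp [Ut, mul_assoc]
  · simp [Ut, h3, mul_assoc, mul_left_comm]

theorem ft_smul (R : Matrix (B × B) E ℂ) (c : ℂ) (γ₁ γ₂ : E → ℂ)
    (h : ft ℂ head tail R γ₁ γ₂ = 0) : ft ℂ head tail R (c • γ₁) (c • γ₂) = 0 := by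
  have : Ft ℂ head tail (c • γ₁) (c • γ₂)
      = (c ^ Fintype.card I * c ^ Fintype.card I) • Ft ℂ head tail γ₁ γ₂ := by
    ext e p
    simp only [Ft, Gt, Ut_smul, Matrix.mul_smul, Matrix.of_apply, Matrix.smul_apply, smul_eq_mul]
    ring
  rw [ft] at h ⊢
  rw [this, Matrix.smul_mul, Matrix.det_smul, h, mul_zero]

/-- univariate polynomial along a line -/
theorem exists_line_poly (R : Matrix (B × B) E ℂ) (a₁ a₂ b₁ b₂ : E → ℂ) :
    ∃ p : ℂ[X], ∀ t, p.eval t = ft ℂ head tail R (a₁ + t • b₁) (a₂ + t • b₂) := by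
  refine ⟨ft ℂ[X] head tail (R.map C) (fun e => C (a₁ e) + X * C (b₁ e))
    (fun e => C (a₂ e) + X * C (b₂ e)), fun t => ?_⟩
  rw [← Polynomial.coe_evalRingHom, ft_map]
  congr 1
  · ext; simp
  · ext; simp; ring
  · ext; simp; ring

theorem line_finite (R : Matrix (B × B) E ℂ) (ρ₁ ρ₂ y₁ y₂ : E → ℂ)
    (h : ft ℂ head tail R ρ₁ ρ₂ ≠ 0) :
    {t : ℂ | ft ℂ head tail R (y₁ + t • ρ₁) (y₂ + t • ρ₂) = 0}.Finite := by
  obtain ⟨p, hp⟩ := exists_line_poly head tail R y₁ y₂ ρ₁ ρ₂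
  obtain ⟨q, hq⟩ := exists_line_poly head tail R ρ₁ ρ₂ y₁ y₂
  by_cases h0 : p = 0
  · exfalso
    have hq0 : q = 0 := by
      apply Polynomial.eq_zero_of_infinite_isRoot
      refine Set.Infinite.mono (s := {0}ᶜ) ?_ (Set.finite_singleton (0 : ℂ)).infinite_compl
      intro s hs
      have hs : s ≠ 0 := hs
      have := hp s⁻¹
      rw [h0, Polynomial.eval_zero] at this
      have := ft_smul head tail R s _ _ this.symm
      simp only [smul_add, smul_smul, mul_inv_cancel₀ hs, one_smul] at this
      show q.eval s = 0
      rw [hq, add_comm ρ₁, add_comm ρ₂]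
      exact this
    apply h
    have := hq 0
    simpa [hq0] using this.symm
  · refine (p.finite_setOfPred_isRoot h0).subset fun t ht => ?_
    show p.eval t = 0
    rw [hp]; exact ht

theorem ft_continuous (R : Matrix (B × B) E ℂ) :
    Continuous fun x : (E → ℂ) × (E → ℂ) => ft ℂ head tail R x.1 x.2 := by
  have hl : Continuous fun γ : E → ℂ => lap ℂ head tail γ := by
    unfold lap
    fun_prop
  have hII : Continuous fun γ : E → ℂ => lapII ℂ head tail γ := hl.matrix_submatrix _ _
  have hIB : Continuous fun γ : E → ℂ => lapIB ℂ head tail γ := hl.matrix_submatrix _ _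
  have hU : Continuous fun γ : E → ℂ => Ut ℂ head tail γ := by
    refine continuous_matrix fun v c => ?_
    rcases v with b | i
    · exact (hII.matrix_det.smul continuous_const).matrix_elem b c
    · exact (hII.matrix_adjugate.matrix_mul hIB).neg.matrix_elem i c
  have hGc : Continuous fun γ : E → ℂ => Gt ℂ head tail γ := continuous_const.matrix_mul hU
  have hF : Continuous fun x : (E → ℂ) × (E → ℂ) => Ft ℂ head tail x.1 x.2 := by
    refine continuous_matrix fun e p => ?_
    exact ((hGc.comp continuous_fst).matrix_elem e p.1).mul
      ((hGc.comp continuous_snd).matrix_elem e p.2)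
  exact (hF.matrix_mul continuous_const).matrix_det

theorem ft_ae (R : Matrix (B × B) E ℂ) (ρ₁ ρ₂ : E → ℂ) (h : ft ℂ head tail R ρ₁ ρ₂ ≠ 0) :
    ∀ᵐ x : (E → ℂ) × (E → ℂ), ft ℂ head tail R x.1 x.2 ≠ 0 := by
  let L : ℂ →ₗ[ℝ] (E → ℂ) × (E → ℂ) :=
    (LinearMap.toSpanSingleton ℂ ((E → ℂ) × (E → ℂ)) (ρ₁, ρ₂)).restrictScalars ℝ
  haveI h1 : (volume : Measure (E → ℂ)).IsAddHaarMeasure := by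
    rw [volume_pi]; infer_instance
  haveI h2 : (volume : Measure ((E → ℂ) × (E → ℂ))).IsAddHaarMeasure := by
    rw [Measure.volume_eq_prod]; exact Measure.prod.instIsAddHaarMeasure _ _
  refine MeasureTheory.ae_mem_of_ae_add_linearMap_mem (𝕜 := ℝ) L (volume : Measure ℂ)
    (volume : Measure ((E → ℂ) × (E → ℂ)))
    (s := {x | ft ℂ head tail R x.1 x.2 ≠ 0}) ?_ ?_
  · exact (isOpen_ne_fun (ft_continuous head tail R) continuous_const).measurableSet
  · rintro ⟨y₁, y₂⟩
    have := (line_finite head tail R ρ₁ ρ₂ y₁ y₂ h).measure_zero (volume : Measure ℂ)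
    rw [ae_iff]
    convert this using 3
    simp [L]

end homog

theorem lap_mul_Ut (head tail : E → B ⊕ I) (γ : E → ℂ)
    (hd : (lapII ℂ head tail γ).det ≠ 0) :
    lap ℂ head tail γ * Ut ℂ head tail γ =
      Matrix.fromRows ((lapII ℂ head tail γ).det • dtn head tail γ 0) 0 := by
  rw [lap_blocks, Ut, Matrix.fromBlocks_mul_fromRows]
  congr 1
  · rw [dtn, Matrix.inv_def, Ring.inverse_eq_inv']
    have : (Matrix.diagonal (0 : I → ℂ)) = 0 := by simp
    rw [this, add_zero]
    simp only [Matrix.mul_neg, Matrix.mul_smul, Matrix.mul_one, Matrix.smul_mul, smul_sub,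
      smul_smul, mul_inv_cancel₀ hd, one_smul, Matrix.mul_assoc]
    rw [sub_eq_add_neg]
  · rw [Matrix.mul_neg, ← Matrix.mul_assoc, Matrix.mul_adjugate]
    simp

theorem quad_identity (head tail : E → B ⊕ I) (γ₁ γ₂ : E → ℂ)
    (hd₁ : (lapII ℂ head tail γ₁).det ≠ 0) (hd₂ : (lapII ℂ head tail γ₂).det ≠ 0) :
    (Gt ℂ head tail γ₁)ᵀ * Matrix.diagonal (γ₁ - γ₂) * Gt ℂ head tail γ₂ =
      ((lapII ℂ head tail γ₁).det * (lapII ℂ head tail γ₂).det) •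
        ((dtn head tail γ₁ 0)ᵀ - dtn head tail γ₂ 0) := by
  have h : ∀ γ : E → ℂ, (Gt ℂ head tail γ₁)ᵀ * Matrix.diagonal γ * Gt ℂ head tail γ₂ =
      (Ut ℂ head tail γ₁)ᵀ * lap ℂ head tail γ * Ut ℂ head tail γ₂ := by
    intro γ
    simp only [Gt, lap, Matrix.transpose_mul, Matrix.mul_assoc]
  have hs : (lap ℂ head tail γ₁)ᵀ = lap ℂ head tail γ₁ := by
    simp [lap, Matrix.transpose_mul, Matrix.mul_assoc]
  have h1 : (Ut ℂ head tail γ₁)ᵀ * lap ℂ head tail γ₁ * Ut ℂ head tail γ₂ =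
      ((lapII ℂ head tail γ₁).det * (lapII ℂ head tail γ₂).det) • (dtn head tail γ₁ 0)ᵀ := by
    rw [← hs, ← Matrix.transpose_mul, lap_mul_Ut _ _ _ hd₁, Ut, Matrix.transpose_fromRows,
      Matrix.fromCols_mul_fromRows]
    simp [smul_smul, mul_comm]
  have h2 : (Ut ℂ head tail γ₁)ᵀ * lap ℂ head tail γ₂ * Ut ℂ head tail γ₂ =
      ((lapII ℂ head tail γ₁).det * (lapII ℂ head tail γ₂).det) • (dtn head tail γ₂ 0) := by
    rw [Matrix.mul_assoc, lap_mul_Ut _ _ _ hd₂, Ut, Matrix.transpose_fromRows,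
      Matrix.fromCols_mul_fromRows]
    simp [smul_smul, mul_comm]
  have hsub : Matrix.diagonal (γ₁ - γ₂) = Matrix.diagonal γ₁ - Matrix.diagonal γ₂ := by
    ext i j; by_cases hij : i = j <;> simp [hij, Matrix.diagonal]
  rw [hsub, Matrix.mul_sub, Matrix.sub_mul, h, h, h1, h2, smul_sub]

theorem eq_of_dtn (head tail : E → B ⊕ I) (R : Matrix (B × B) E ℂ) (γ₁ γ₂ : E → ℂ)
    (hd₁ : (lapII ℂ head tail γ₁).det ≠ 0) (hd₂ : (lapII ℂ head tail γ₂).det ≠ 0)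
    (hΛ : dtn head tail γ₁ 0 = dtn head tail γ₂ 0) (hf : ft ℂ head tail R γ₁ γ₂ ≠ 0) :
    γ₁ = γ₂ := by
  have hsym : (dtn head tail γ₁ 0)ᵀ - dtn head tail γ₁ 0 = 0 := by
    have := quad_identity head tail γ₁ γ₁ hd₁ hd₁
    have hz : Matrix.diagonal (γ₁ - γ₁) = 0 := by simp
    rw [hz, Matrix.mul_zero, Matrix.zero_mul] at this
    exact (smul_eq_zero.1 this.symm).resolve_left (mul_ne_zero hd₁ hd₁)
  have hq := quad_identity head tail γ₁ γ₂ hd₁ hd₂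
  rw [← hΛ, hsym, smul_zero] at hq
  have hv : (γ₁ - γ₂) ᵥ* Ft ℂ head tail γ₁ γ₂ = 0 := by
    ext p
    have := congrFun (congrFun hq p.1) p.2
    rw [Matrix.mul_apply] at this
    simp only [Matrix.mul_diagonal, Matrix.transpose_apply, Matrix.zero_apply] at this
    rw [Pi.zero_apply, ← this]
    refine Finset.sum_congr rfl fun e _ => ?_
    simp only [Ft, Matrix.of_apply]
    ring
  have hv2 : (γ₁ - γ₂) ᵥ* (Ft ℂ head tail γ₁ γ₂ * R) = 0 := by
    rw [← Matrix.vecMul_vecMul, hv, Matrix.zero_vecMul]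
  exact sub_eq_zero.1 (Matrix.eq_zero_of_vecMul_eq_zero hf hv2)

theorem harmonic_eq (head tail : E → B ⊕ I) (γ : E → ℂ) (u : B ⊕ I → ℂ)
    (hd : (lapII ℂ head tail γ).det ≠ 0) (hu : Harmonic head tail γ 0 u) :
    grad head tail u = (lapII ℂ head tail γ).det⁻¹ •
      (Gt ℂ head tail γ *ᵥ (u ∘ Sum.inl)) := by
  have h1 : lapIB ℂ head tail γ *ᵥ (u ∘ Sum.inl) + lapII ℂ head tail γ *ᵥ (u ∘ Sum.inr) = 0 := by
    ext i
    have := hu i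
    rw [lap_blocks, Matrix.fromBlocks_mulVec] at this
    simpa using this
  have h2 : (lapII ℂ head tail γ).det • u = Ut ℂ head tail γ *ᵥ (u ∘ Sum.inl) := by
    rw [Ut, Matrix.fromRows_mulVec]
    have h3 := congrArg (fun w => (lapII ℂ head tail γ).adjugate *ᵥ w) h1
    simp only [Matrix.mulVec_add, Matrix.mulVec_mulVec, Matrix.adjugate_mul, Matrix.mulVec_zero,
      Matrix.smul_mulVec, Matrix.one_mulVec] at h3
    ext (b | i)
    · simp [Matrix.smul_mulVec]
    · have := congrFun h3 i
      simp only [Pi.add_apply, Pi.smul_apply, Function.comp, Pi.zero_apply] at this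
      simp only [Sum.elim_inr, Matrix.neg_mulVec, Pi.neg_apply, Pi.smul_apply]
      linear_combination this
  rw [Gt, ← Matrix.mulVec_mulVec, ← h2, Matrix.mulVec_smul, smul_smul, inv_mul_cancel₀ hd,
    one_smul, incMat_mulVec]

theorem exists_R (head tail : E → B ⊕ I) (ρ₁ ρ₂ : E → ℂ)
    (hd₁ : (lapII ℂ head tail ρ₁).det ≠ 0) (hd₂ : (lapII ℂ head tail ρ₂).det ≠ 0)
    (hP : Pspace head tail ρ₁ ρ₂ = ⊤) :
    ∃ R : Matrix (B × B) E ℂ, ft ℂ head tail R ρ₁ ρ₂ ≠ 0 := by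
  have hle : Pspace head tail ρ₁ ρ₂ ≤ LinearMap.range (Ft ℂ head tail ρ₁ ρ₂).mulVecLin := by
    refine Submodule.span_le.2 ?_
    rintro w ⟨u, v, hu, hv, rfl⟩
    refine ⟨fun p => ((lapII ℂ head tail ρ₁).det⁻¹ * (lapII ℂ head tail ρ₂).det⁻¹) *
      (u (Sum.inl p.1) * v (Sum.inl p.2)), ?_⟩
    ext e
    rw [harmonic_eq _ _ _ _ hd₁ hu, harmonic_eq _ _ _ _ hd₂ hv]
    simp only [Matrix.mulVecLin_apply, Matrix.mulVec, dotProduct, Pi.smul_apply, smul_eq_mul,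
      Function.comp, Ft, Matrix.of_apply, Fintype.sum_prod_type]
    rw [mul_mul_mul_comm, Finset.sum_mul_sum, Finset.mul_sum]
    refine Finset.sum_congr rfl fun b _ => ?_
    rw [Finset.mul_sum]
    refine Finset.sum_congr rfl fun c _ => ?_
    ring
  have hs : Function.Surjective (Ft ℂ head tail ρ₁ ρ₂).mulVec := by
    rw [hP, top_le_iff] at hle
    exact LinearMap.range_eq_top.1 hle
  obtain ⟨R, hR⟩ := Matrix.mulVec_surjective_iff_exists_right_inverse.1 hs
  exact ⟨R, by rw [ft, hR]; simp⟩

end helpers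

/-- if `P(ρ₁,ρ₂) = ℂ^E` for some `ρ₁,ρ₂ ∈ ℂ_0^E`, then every
equivalence class for `Λ_{γ₁,0} = Λ_{γ₂,0}` has Lebesgue measure zero in `ℂ^E`. -/
theorem equiv_class_measure_zero_cond [Nonempty B] (head tail : E → B ⊕ I)
    (hG : Gconn head tail) (hGI : GIconn head tail)
    (ρ₁ ρ₂ : E → ℂ) (hρ₁ : ∀ e, 0 < (ρ₁ e).re) (hρ₂ : ∀ e, 0 < (ρ₂ e).re)
    (hP : Pspace head tail ρ₁ ρ₂ = ⊤)
    (γ₀ : E → ℂ) (hγ₀ : ∀ e, 0 < (γ₀ e).re) :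
    volume { γ : E → ℂ | (∀ e, 0 < (γ e).re) ∧
      dtn head tail γ 0 = dtn head tail γ₀ 0 } = 0 := by
  have hI : Nonempty I := hGI.nonempty
  have hE : Nonempty E := by
    by_contra hne
    rw [not_nonempty_iff] at hne
    obtain ⟨b⟩ := ‹Nonempty B›
    obtain ⟨i⟩ := hI
    have := const_of_conn head tail hG (Sum.elim (fun _ => true) (fun _ => false))
      (fun e => hne.elim e) (Sum.inl b) (Sum.inr i)
    simp at this
  obtain ⟨R, hR⟩ := exists_R head tail ρ₁ ρ₂ (det_lapII_ne head tail hG ρ₁ hρ₁)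
    (det_lapII_ne head tail hG ρ₂ hρ₂) hP
  have hae := ft_ae head tail R ρ₁ ρ₂ hR
  set A := { γ : E → ℂ | (∀ e, 0 < (γ e).re) ∧ dtn head tail γ 0 = dtn head tail γ₀ 0 } with hA
  have hdiag : (volume : Measure ((E → ℂ) × (E → ℂ))) {x | x.1 = x.2} = 0 := by
    rw [Measure.volume_eq_prod, Measure.measure_prod_null
      (isClosed_eq continuous_fst continuous_snd).measurableSet]
    refine Filter.Eventually.of_forall fun x => ?_
    have : Prod.mk x ⁻¹' {y : (E → ℂ) × (E → ℂ) | y.1 = y.2} = {x} := by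
      ext y; simp [eq_comm]
    show volume (Prod.mk x ⁻¹' {y : (E → ℂ) × (E → ℂ) | y.1 = y.2}) = 0
    rw [this]
    simp
  have hAA : (volume : Measure ((E → ℂ) × (E → ℂ))) (A ×ˢ A) = 0 := by
    refine measure_mono_null (t := {x | ¬ ft ℂ head tail R x.1 x.2 ≠ 0} ∪ {x | x.1 = x.2}) ?_
      (measure_union_null (ae_iff.1 hae) hdiag)
    rintro ⟨γ₁, γ₂⟩ ⟨h1, h2⟩
    by_cases hf : ft ℂ head tail R γ₁ γ₂ = 0
    · left; simpa using hf
    · right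
      exact eq_of_dtn head tail R γ₁ γ₂ (det_lapII_ne head tail hG γ₁ h1.1)
        (det_lapII_ne head tail hG γ₂ h2.1) (h1.2.trans h2.2.symm) hf
  rw [Measure.volume_eq_prod, Measure.prod_prod] at hAA
  exact mul_self_eq_zero.1 hAA

end

end DIP
end

section
/- Assume G and the subgraph G_I induced on the interior nodes are connected. Let γ ∈ ℂ_0^E and let ζ = −λ_min((L_{Re γ})_{II}) be the negative of the smallest eigenvalue of the (positive definite) real symmetric matrix (L_{Re γ})_{II}. If Q(p_1,p_2) = ℂ^I for some p_1, p_2 ∈ ℂ_ζ^I, then the set {(q_1,q_2) ∈ ℂ_ζ^I × ℂ_ζ^I : Q(q_1,q_2) ≠ ℂ^I} has Lebesgue measure zero in ℂ^I × ℂ^I; in other words, Q(q_1,q_2) = ℂ^I for almost all (q_1,q_2) ∈ ℂ_ζ^I × ℂ_ζ^I. -/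
/-!
Common setup: a finite graph whose vertex set is partitioned into boundary
nodes `B` and interior nodes `I` (so the vertex set is `B ⊕ I`), with edge
set `E` and a fixed orientation given by maps `head tail : E → B ⊕ I`.
-/

open Matrix MeasureTheory

namespace DIP

noncomputable section

variable {B I E : Type*} [Fintype B] [Fintype I] [Fintype E]
  [DecidableEq B] [DecidableEq I] [DecidableEq E]

def incI (α : Type*) [CommRing α] (head tail : E → B ⊕ I) : Matrix E I α :=
  (incMat α head tail).submatrix id Sum.inr

omit [Fintype B] [Fintype I] in
lemma lapII_eq (α : Type*) [CommRing α] (head tail : E → B ⊕ I) (γ : E → α) :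
    lapII α head tail γ = (incI α head tail)ᵀ * Matrix.diagonal γ * incI α head tail := by
  ext i j
  simp [lapII, lap, incI, Matrix.mul_apply]

omit [Fintype B] in
lemma quad (α : Type*) [CommRing α] (head tail : E → B ⊕ I) (γ : E → α) (x y : I → α) :
    x ⬝ᵥ (lapII α head tail γ).mulVec y =
      ∑ e, γ e * ((incI α head tail).mulVec x e * (incI α head tail).mulVec y e) := by
  rw [lapII_eq, ← Matrix.mulVec_mulVec, ← Matrix.mulVec_mulVec, Matrix.dotProduct_mulVec,
    Matrix.vecMul_transpose, dotProduct]
  refine Finset.sum_congr rfl fun e _ => ?_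
  rw [Matrix.mulVec_diagonal]
  ring

omit [Fintype B] in
lemma lambdaMin_le (head tail : E → B ⊕ I) (γ : E → ℝ) (hγ : ∀ e, 0 < γ e) (a : I → ℝ) :
    lambdaMin (lapII ℝ head tail γ) * ∑ i, a i ^ 2 ≤ a ⬝ᵥ (lapII ℝ head tail γ).mulVec a := by
  have hpos : ∀ a : I → ℝ, 0 ≤ a ⬝ᵥ (lapII ℝ head tail γ).mulVec a := by
    intro a
    rw [quad]
    exact Finset.sum_nonneg fun e _ => mul_nonneg (hγ e).le (mul_self_nonneg _)
  have hs : 0 ≤ ∑ i, a i ^ 2 := Finset.sum_nonneg fun i _ => sq_nonneg _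
  rcases hs.eq_or_lt with h | h
  · rw [← h, mul_zero]; exact hpos a
  · set s := ∑ i, a i ^ 2 with hsdef
    have hr : (Real.sqrt s)⁻¹ ^ 2 = s⁻¹ := by rw [inv_pow, Real.sq_sqrt hs]
    have hx : ∑ i, ((Real.sqrt s)⁻¹ • a) i ^ 2 = 1 := by
      simp only [Pi.smul_apply, smul_eq_mul, mul_pow, ← Finset.mul_sum, hr]
      rw [← hsdef]; exact inv_mul_cancel₀ h.ne'
    have key : lambdaMin (lapII ℝ head tail γ) ≤ _ :=
      ciInf_le (f := fun x : { x : I → ℝ // ∑ i, x i ^ 2 = 1 } =>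
        (x : I → ℝ) ⬝ᵥ (lapII ℝ head tail γ).mulVec (x : I → ℝ))
        ⟨0, by rintro _ ⟨x, rfl⟩; exact hpos _⟩ ⟨_, hx⟩
    simp only [Matrix.mulVec_smul, smul_dotProduct, dotProduct_smul, smul_eq_mul] at key
    rw [← mul_assoc, ← sq, hr, inv_mul_eq_div, le_div_iff₀ h] at key
    exact key

omit [Fintype B] in
lemma det_ne (head tail : E → B ⊕ I) (γ : E → ℂ) (hγ : ∀ e, 0 < (γ e).re)
    (ζ : ℝ) (hζ : ζ = -lambdaMin (lapII ℝ head tail fun e => (γ e).re))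
    (p : I → ℂ) (hp : ∀ i, ζ < (p i).re) :
    (lapII ℂ head tail γ + Matrix.diagonal p).det ≠ 0 := by
  intro hdet
  obtain ⟨x, hx0, hx⟩ := Matrix.exists_mulVec_eq_zero_iff.mpr hdet
  have h1 : (star x) ⬝ᵥ (lapII ℂ head tail γ + Matrix.diagonal p).mulVec x = 0 := by
    rw [hx, dotProduct_zero]
  rw [Matrix.add_mulVec, dotProduct_add, quad] at h1
  have hre : ∀ e, ((incI ℂ head tail).mulVec x e).re
      = (incI ℝ head tail).mulVec (fun i => (x i).re) e := by
    intro e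
    simp only [Matrix.mulVec, dotProduct, Complex.re_sum]
    refine Finset.sum_congr rfl fun i _ => ?_
    simp only [incI, incMat, Matrix.submatrix_apply, Matrix.of_apply, id]
    split_ifs <;> simp
  have him : ∀ e, ((incI ℂ head tail).mulVec x e).im
      = (incI ℝ head tail).mulVec (fun i => (x i).im) e := by
    intro e
    simp only [Matrix.mulVec, dotProduct, Complex.im_sum]
    refine Finset.sum_congr rfl fun i _ => ?_
    simp only [incI, incMat, Matrix.submatrix_apply, Matrix.of_apply, id]
    split_ifs <;> simp
  have hstar : ∀ e, (incI ℂ head tail).mulVec (star x) e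
      = star ((incI ℂ head tail).mulVec x e) := by
    intro e
    simp only [Matrix.mulVec, dotProduct, star_sum]
    refine Finset.sum_congr rfl fun i _ => ?_
    simp only [incI, incMat, Matrix.submatrix_apply, Matrix.of_apply, id]
    split_ifs <;> simp
  have h2 := congrArg Complex.re h1
  rw [Complex.add_re, Complex.re_sum, Complex.zero_re, dotProduct, Complex.re_sum] at h2
  have e1 : ∑ e, (γ e * ((incI ℂ head tail).mulVec (star x) e *
      (incI ℂ head tail).mulVec x e)).re
      = (fun i => (x i).re) ⬝ᵥ (lapII ℝ head tail fun e => (γ e).re).mulVec (fun i => (x i).re)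
      + (fun i => (x i).im) ⬝ᵥ (lapII ℝ head tail fun e => (γ e).re).mulVec (fun i => (x i).im) := by
    rw [quad, quad, ← Finset.sum_add_distrib]
    refine Finset.sum_congr rfl fun e _ => ?_
    rw [hstar, ← hre, ← him]
    simp [Complex.mul_re, Complex.mul_im]
    ring
  have e2 : ∑ i, (star x i * (Matrix.diagonal p).mulVec x i).re
      = ∑ i, (p i).re * ((x i).re ^ 2 + (x i).im ^ 2) := by
    refine Finset.sum_congr rfl fun i _ => ?_
    rw [Matrix.mulVec_diagonal]
    simp [Complex.mul_re, Complex.mul_im]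
    ring
  have e3 : ∑ i, ζ * ((x i).re ^ 2 + (x i).im ^ 2)
      < ∑ i, (p i).re * ((x i).re ^ 2 + (x i).im ^ 2) := by
    obtain ⟨j, hj⟩ := Function.ne_iff.mp hx0
    refine Finset.sum_lt_sum (fun i _ => mul_le_mul_of_nonneg_right (hp i).le (by positivity))
      ⟨j, Finset.mem_univ _, mul_lt_mul_of_pos_right (hp j) ?_⟩
    have := Complex.normSq_pos.mpr hj
    rw [Complex.normSq_apply] at this
    nlinarith
  have l1 := lambdaMin_le head tail (fun e => (γ e).re) hγ (fun i => (x i).re)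
  have l2 := lambdaMin_le head tail (fun e => (γ e).re) hγ (fun i => (x i).im)
  rw [← Finset.mul_sum, Finset.sum_add_distrib, hζ] at e3
  rw [e1, e2] at h2
  linarith

/-- `adj(A + diag q) C` -/
def Wm {R : Type*} [CommRing R] (A : Matrix I I R) (C : Matrix I B R) (q : I → R) :
    Matrix I B R :=
  (A + Matrix.diagonal q).adjugate * C

def FF {R : Type*} [CommRing R] (A : Matrix I I R) (C : Matrix I B R) (q₁ q₂ : I → R) :
    Matrix I (B × B) R :=
  Matrix.of fun i c => Wm A C q₁ i c.1 * Wm A C q₂ i c.2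

def PP {R : Type*} [CommRing R] (A : Matrix I I R) (C : Matrix I B R) (G : Matrix (B × B) I R)
    (q₁ q₂ : I → R) : R :=
  (FF A C q₁ q₂ * G).det

omit [Fintype B] [DecidableEq B] in
lemma Wm_map {R S : Type*} [CommRing R] [CommRing S] (f : R →+* S) (A : Matrix I I R)
    (C : Matrix I B R) (q : I → R) :
    (Wm A C q).map f = Wm (A.map f) (C.map f) (fun i => f (q i)) := by
  have : (A + Matrix.diagonal q).map f = A.map f + Matrix.diagonal (fun i => f (q i)) := by
    rw [Matrix.map_add f (map_add f), Matrix.diagonal_map (map_zero f)]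
  have h2 := RingHom.map_adjugate f (A + Matrix.diagonal q)
  simp only [RingHom.mapMatrix_apply] at h2
  rw [Wm, Wm, Matrix.map_mul, h2, this]

omit [DecidableEq B] in
lemma PP_map {R S : Type*} [CommRing R] [CommRing S] (f : R →+* S) (A : Matrix I I R)
    (C : Matrix I B R) (G : Matrix (B × B) I R) (q₁ q₂ : I → R) :
    f (PP A C G q₁ q₂) =
      PP (A.map f) (C.map f) (G.map f) (fun i => f (q₁ i)) (fun i => f (q₂ i)) := by
  have : (FF A C q₁ q₂).map f =
      FF (A.map f) (C.map f) (fun i => f (q₁ i)) (fun i => f (q₂ i)) := by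
    ext i c
    simp only [FF, Matrix.map_apply, Matrix.of_apply, map_mul, ← Wm_map]
  rw [PP, RingHom.map_det, RingHom.mapMatrix_apply, Matrix.map_mul, this, PP]

omit [DecidableEq B] in
lemma PP_null (A : Matrix I I ℂ) (C : Matrix I B ℂ) (G : Matrix (B × B) I ℂ) (p₁ p₂ : I → ℂ)
    (hP : PP A C G p₁ p₂ ≠ 0) :
    volume { r : (I → ℂ) × (I → ℂ) | PP A C G r.1 r.2 = 0 } = 0 := by
  have hW : ∀ g : (I → ℂ) × (I → ℂ) → (I → ℂ), Continuous g →
      Continuous fun r => Wm A C (g r) := by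
    intro g hg
    exact ((continuous_const.add hg.matrix_diagonal).matrix_adjugate).matrix_mul continuous_const
  have hc : Continuous fun r : (I → ℂ) × (I → ℂ) => PP A C G r.1 r.2 := by
    refine Continuous.matrix_det (Continuous.matrix_mul ?_ continuous_const)
    refine continuous_matrix fun i c => ?_
    exact ((hW _ continuous_fst).matrix_elem _ _).mul ((hW _ continuous_snd).matrix_elem _ _)
  set Z : Set ((I → ℂ) × (I → ℂ)) := { r | PP A C G r.1 r.2 = 0 } with hZ
  have hZm : MeasurableSet Z := (isClosed_singleton.preimage hc).measurableSet
  set S : Set (((I → ℂ) × (I → ℂ)) × ℝ) := { y | (p₁, p₂) + y.2 • y.1 ∈ Z } with hS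
  have hSm : MeasurableSet S := by
    have : Continuous fun y : ((I → ℂ) × (I → ℂ)) × ℝ => (p₁, p₂) + y.2 • y.1 := by fun_prop
    exact this.measurable hZm
  have hS0 : (volume.prod volume : Measure (((I → ℂ) × (I → ℂ)) × ℝ)) S = 0 := by
    rw [Measure.measure_prod_null hSm]
    refine Filter.Eventually.of_forall fun x => ?_
    let pol : Polynomial ℂ := PP (A.map Polynomial.C) (C.map Polynomial.C) (G.map Polynomial.C)
      (fun i => Polynomial.C (p₁ i) + Polynomial.X * Polynomial.C (x.1 i))
      (fun i => Polynomial.C (p₂ i) + Polynomial.X * Polynomial.C (x.2 i))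
    have hpol : ∀ t : ℂ, pol.eval t = PP A C G (p₁ + t • x.1) (p₂ + t • x.2) := by
      intro t
      have := PP_map (Polynomial.evalRingHom t) (A.map Polynomial.C) (C.map Polynomial.C)
        (G.map Polynomial.C)
        (fun i => Polynomial.C (p₁ i) + Polynomial.X * Polynomial.C (x.1 i))
        (fun i => Polynomial.C (p₂ i) + Polynomial.X * Polynomial.C (x.2 i))
      have hm' : ∀ (N : Matrix (B × B) I ℂ),
          (N.map Polynomial.C).map (Polynomial.evalRingHom t) = N := by
        intro N; ext; simp
      have hm2 : ∀ (N : Matrix I B ℂ),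
          (N.map Polynomial.C).map (Polynomial.evalRingHom t) = N := by
        intro N; ext; simp
      have hm3 : ∀ (N : Matrix I I ℂ),
          (N.map Polynomial.C).map (Polynomial.evalRingHom t) = N := by
        intro N; ext; simp
      rw [hm', hm2, hm3] at this
      rw [← Polynomial.coe_evalRingHom, this]
      congr 1 <;> (ext i; simp; ring)
    have hne : pol ≠ 0 := by
      intro h
      have := hpol 0
      rw [h] at this
      simp at this
      exact hP this.symm
    have hfin : (Prod.mk x ⁻¹' S).Finite := by
      refine ((Polynomial.finite_setOfPred_isRoot hne).preimage
        (Complex.ofReal_injective.injOn)).subset ?_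
      intro t ht
      have ht' : PP A C G (p₁ + t • x.1) (p₂ + t • x.2) = 0 := ht
      show pol.eval (t : ℂ) = 0
      rw [hpol]
      exact ht'
    exact hfin.measure_zero _
  have hS1 := Measure.measure_ae_null_of_prod_null
    (μ := (volume : Measure ℝ)) (ν := (volume : Measure ((I → ℂ) × (I → ℂ))))
    (s := Prod.swap ⁻¹' S) (by
      rw [← Measure.map_apply measurable_swap hSm, Measure.prod_swap]; exact hS0)
  have hne0 : ∀ᵐ t : ℝ, t ≠ 0 := by
    simp [ae_iff]
  obtain ⟨t, ht, ht0⟩ := (hS1.and hne0).exists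
  have h3 : (Prod.mk t ⁻¹' (Prod.swap ⁻¹' S)) =
      (fun x : (I → ℂ) × (I → ℂ) => t • x) ⁻¹' ((fun x => (p₁, p₂) + x) ⁻¹' Z) := rfl
  simp only [Pi.zero_apply] at ht
  haveI hpi : (volume : Measure (I → ℂ)).IsAddHaarMeasure := inferInstance
  haveI hpr : (volume : Measure ((I → ℂ) × (I → ℂ))).IsAddHaarMeasure := by
    change ((volume : Measure (I → ℂ)).prod (volume : Measure (I → ℂ))).IsAddHaarMeasure
    exact Measure.prod.instIsAddHaarMeasure _ _
  rw [h3, Measure.addHaar_preimage_smul volume ht0, measure_preimage_add] at ht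
  simpa [ht0] using ht

lemma harm_iff (head tail : E → B ⊕ I) (γ : E → ℂ) (q : I → ℂ) (u : B ⊕ I → ℂ) :
    Harmonic head tail γ q u ↔
      (lapII ℂ head tail γ + Matrix.diagonal q).mulVec (fun i => u (Sum.inr i)) +
        (lapIB ℂ head tail γ).mulVec (fun b => u (Sum.inl b)) = 0 := by
  rw [Harmonic, funext_iff]
  refine forall_congr' fun i => ?_
  rw [Matrix.add_mulVec]
  simp only [Pi.add_apply, Matrix.mulVec_diagonal, Pi.zero_apply]
  simp only [Matrix.mulVec, dotProduct, Fintype.sum_sum_type, lapII, lapIB,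
    Matrix.submatrix_apply]
  constructor <;> intro h <;> linear_combination h

lemma harm_sol (head tail : E → B ⊕ I) (γ : E → ℂ) (q : I → ℂ) (b : B) :
    Harmonic head tail γ q (Sum.elim
      (-(lapII ℂ head tail γ + Matrix.diagonal q).det • Pi.single b 1)
      (fun i => Wm (lapII ℂ head tail γ) (lapIB ℂ head tail γ) q i b)) := by
  rw [harm_iff]
  have : (fun i => Wm (lapII ℂ head tail γ) (lapIB ℂ head tail γ) q i b)
      = (Wm (lapII ℂ head tail γ) (lapIB ℂ head tail γ) q).mulVec (Pi.single b 1) := by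
    rw [Matrix.mulVec_single_one]; rfl
  simp only [Sum.elim_inr, Sum.elim_inl]
  rw [this, Wm, Matrix.mulVec_mulVec, ← Matrix.mul_assoc, Matrix.mul_adjugate]
  erw [Matrix.mulVec_smul]
  rw [Matrix.smul_mul, Matrix.one_mul, Matrix.smul_mulVec, neg_smul, add_neg_cancel]

lemma harm_rep (head tail : E → B ⊕ I) (γ : E → ℂ) (q : I → ℂ)
    (hdet : (lapII ℂ head tail γ + Matrix.diagonal q).det ≠ 0) (u : B ⊕ I → ℂ)
    (hu : Harmonic head tail γ q u) : ∃ α : B → ℂ, (fun i => u (Sum.inr i)) =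
      (Wm (lapII ℂ head tail γ) (lapIB ℂ head tail γ) q).mulVec α := by
  rw [harm_iff] at hu
  set M := lapII ℂ head tail γ + Matrix.diagonal q with hM
  refine ⟨(-M.det⁻¹) • fun b => u (Sum.inl b), ?_⟩
  have h := congrArg (fun w => M.adjugate.mulVec w) hu
  simp only [Matrix.mulVec_add, Matrix.mulVec_mulVec, Matrix.adjugate_mul, Matrix.smul_mulVec,
    Matrix.one_mulVec, Matrix.mulVec_zero] at h
  rw [Matrix.mulVec_smul, Wm, ← hM]
  funext i
  have hi := congrFun h i
  simp only [Pi.add_apply, Pi.smul_apply, smul_eq_mul, Pi.zero_apply] at hi ⊢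
  field_simp
  linear_combination hi

/-- with `ζ = -λ_min((L_{Re γ})_II)`, if `Q(p₁,p₂) = ℂ^I` for some
`p₁,p₂ ∈ ℂ_ζ^I`, then `{(q₁,q₂) ∈ ℂ_ζ^I × ℂ_ζ^I : Q(q₁,q₂) ≠ ℂ^I}` has
Lebesgue measure zero. -/
theorem uniqueness_ae_schroe [Nonempty B] (head tail : E → B ⊕ I)
    (hG : Gconn head tail) (hGI : GIconn head tail)
    (γ : E → ℂ) (hγ : ∀ e, 0 < (γ e).re)
    (ζ : ℝ) (hζ : ζ = -lambdaMin (lapII ℝ head tail fun e => (γ e).re))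
    (p₁ p₂ : I → ℂ) (hp₁ : ∀ i, ζ < (p₁ i).re) (hp₂ : ∀ i, ζ < (p₂ i).re)
    (hQ : Qspace head tail γ p₁ p₂ = ⊤) :
    volume { r : (I → ℂ) × (I → ℂ) |
      (∀ i, ζ < (r.1 i).re) ∧ (∀ i, ζ < (r.2 i).re) ∧
        Qspace head tail γ r.1 r.2 ≠ ⊤ } = 0 := by
  set A := lapII ℂ head tail γ with hA
  set C := lapIB ℂ head tail γ with hC
  have d₁ := det_ne head tail γ hγ ζ hζ p₁ hp₁
  have d₂ := det_ne head tail γ hγ ζ hζ p₂ hp₂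
  have hle : Qspace head tail γ p₁ p₂ ≤ LinearMap.range (FF A C p₁ p₂).mulVecLin := by
    refine Submodule.span_le.mpr ?_
    rintro w ⟨u, v, hu, hv, rfl⟩
    obtain ⟨a, ha⟩ := harm_rep head tail γ p₁ d₁ u hu
    obtain ⟨b, hb⟩ := harm_rep head tail γ p₂ d₂ v hv
    refine ⟨fun c => a c.1 * b c.2, ?_⟩
    funext i
    have hai := congrFun ha i
    have hbi := congrFun hb i
    rw [Matrix.mulVecLin_apply]
    show _ = u (Sum.inr i) * v (Sum.inr i)
    rw [hai, hbi]
    simp only [Matrix.mulVec, dotProduct, FF, Matrix.of_apply, Finset.sum_mul_sum,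
      Fintype.sum_prod_type]
    refine Finset.sum_congr rfl fun x _ => Finset.sum_congr rfl fun y _ => ?_
    ring
  rw [hQ, top_le_iff, LinearMap.range_eq_top] at hle
  obtain ⟨G, hGr⟩ := Matrix.mulVec_surjective_iff_exists_right_inverse.mp hle
  have hP : PP A C G p₁ p₂ ≠ 0 := by
    rw [PP, hGr, Matrix.det_one]; exact one_ne_zero
  refine measure_mono_null ?_ (PP_null A C G p₁ p₂ hP)
  rintro r ⟨-, -, hr⟩
  by_contra hne
  apply hr
  have hunit : IsUnit (FF A C r.1 r.2 * G) := by
    rw [Matrix.isUnit_iff_isUnit_det]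
    exact isUnit_iff_ne_zero.mpr hne
  rw [eq_top_iff]
  intro w _
  obtain ⟨z, hz⟩ := Matrix.mulVec_surjective_iff_isUnit.mpr hunit w
  rw [← Matrix.mulVec_mulVec] at hz
  rw [← hz, Matrix.mulVec_eq_sum]
  refine Submodule.sum_mem _ fun c _ => ?_
  rw [op_smul_eq_smul]
  refine Submodule.smul_mem _ _ (Submodule.subset_span ?_)
  exact ⟨_, _, harm_sol head tail γ r.1 c.1, harm_sol head tail γ r.2 c.2, rfl⟩

end

end DIP
end
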